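/- Fix a type T of tuples, a value function v : T → ℝ and a bound M ≥ 0 with |v(t)| ≤ M for every t : T. Fix predicates φ_i, φ_j, p : T → Prop, and for a finite multiset D of elements of T write s(ψ, D) = Σ_{t ∈ D, ψ(t)} v(t) (summed with multiplicity) and c(ψ, D) for the number of tuples in D satisfying ψ. Define the SUM-influence I(p; D) = (s(φ_i ∧ p, D) − s(φ_j ∧ p, D)) · min(c(φ_i ∧ ¬p, D), c(φ_j ∧ ¬p, D)) / (max(c(φ_i, D), c(φ_j, D)) + 1), computed over the real numbers. Then for all neighboring databases D and D', |I(p; D) − I(p; D')| ≤ 4M. -/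

import Mathlib

/-- If every summand is at most `M` in absolute value, a sum over a multiset is at most `M` times
its cardinality. -/
theorem abs_sum_map_le_mul_card {T : Type*} {v : T → ℝ} {M : ℝ} (hv : ∀ t, |v t| ≤ M)
    (D : Multiset T) : |(D.map v).sum| ≤ M * D.card := by
  induction D using Multiset.induction_on with
  | empty => simp
  | cons t D ih =>
    rw [Multiset.map_cons, Multiset.sum_cons, Multiset.card_cons, Nat.cast_succ]
    linarith [abs_add_le (v t) (D.map v).sum, hv t]

/-- Variation of `S * m / X` when `S` moves by at most `M` and `m`, `X` grow by at most one. -/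
theorem abs_mul_div_sub_mul_div_le {S S' m m' X X' M : ℝ} (hM : 0 ≤ M)
    (hX : 0 < X) (hm : 0 ≤ m) (hmX' : m' ≤ X')
    (hm_le : m ≤ m') (hm_succ : m' ≤ m + 1) (hX_le : X ≤ X') (hX_succ : X' ≤ X + 1)
    (hS : |S| ≤ 2 * M * X) (hSS : |S' - S| ≤ M) :
    |S * m / X - S' * m' / X'| ≤ 3 * M := by
  have hX' : 0 < X' := hX.trans_le hX_le
  have hfst : |(S' - S) * (m' / X')| ≤ M := by
    have h0 : 0 ≤ m' / X' := div_nonneg (hm.trans hm_le) hX'.le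
    have h1 : m' / X' ≤ 1 := (div_le_one hX').2 hmX'
    rw [abs_mul, abs_of_nonneg h0]
    nlinarith [abs_nonneg (S' - S)]
  have hquot : |m' / X' - m / X| ≤ 1 / X := by
    have hnum : |m' * X - X' * m| ≤ X' := by
      rw [abs_le]
      constructor <;> nlinarith
    rw [div_sub_div _ _ hX'.ne' hX.ne', abs_div, abs_of_pos (mul_pos hX' hX),
      div_le_div_iff₀ (mul_pos hX' hX) hX]
    nlinarith
  have hsnd : |S * (m' / X' - m / X)| ≤ 2 * M := by
    calc |S * (m' / X' - m / X)| ≤ 2 * M * X * (1 / X) := by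
          rw [abs_mul]; gcongr
      _ = 2 * M := by field_simp
  have hsplit : S * m / X - S' * m' / X'
      = -((S' - S) * (m' / X') + S * (m' / X' - m / X)) := by ring
  rw [hsplit, abs_neg]
  linarith [abs_add_le ((S' - S) * (m' / X')) (S * (m' / X' - m / X))]

/-- Adding a tuple leaves a filtered count unchanged or increases it by one. -/
theorem card_filter_cons_bounds {T : Type*} (q : T → Prop) [DecidablePred q] (t : T)
    (D : Multiset T) :
    ((D.filter q).card : ℝ) ≤ ((t ::ₘ D).filter q).card ∧
      (((t ::ₘ D).filter q).card : ℝ) ≤ (D.filter q).card + 1 := by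
  by_cases h : q t <;> simp [h]

/-- The sensitivity bound when one tuple is added. -/
theorem abs_sum_influence_sub_cons_le {T : Type*} {v : T → ℝ} {M : ℝ} (hM : 0 ≤ M)
    (hv : ∀ t : T, |v t| ≤ M)
    (φi φj p : T → Prop) [DecidablePred φi] [DecidablePred φj] [DecidablePred p]
    {I : Multiset T → ℝ}
    (hI : ∀ D : Multiset T,
      I D = (((D.filter fun t => φi t ∧ p t).map v).sum
              - ((D.filter fun t => φj t ∧ p t).map v).sum)
            * min ((D.filter fun t => φi t ∧ ¬ p t).card : ℝ)
                  ((D.filter fun t => φj t ∧ ¬ p t).card : ℝ)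
            / (max ((D.filter φi).card : ℝ) ((D.filter φj).card : ℝ) + 1))
    (D : Multiset T) (t : T) : |I D - I (t ::ₘ D)| ≤ 3 * M := by
  have card_le (φ q : T → Prop) [DecidablePred φ] [DecidablePred q] (E : Multiset T) :
      ((E.filter fun t => φ t ∧ q t).card : ℝ) ≤ (E.filter φ).card := by
    exact_mod_cast Multiset.card_le_card
      (Multiset.monotone_filter_right E fun _ (h : φ _ ∧ q _) => h.1)
  have min_le (E : Multiset T) :
      min ((E.filter fun t => φi t ∧ ¬ p t).card : ℝ) ((E.filter fun t => φj t ∧ ¬ p t).card : ℝ)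
        ≤ max ((E.filter φi).card : ℝ) ((E.filter φj).card : ℝ) + 1 := by
    linarith [min_le_left ((E.filter fun t => φi t ∧ ¬ p t).card : ℝ)
      ((E.filter fun t => φj t ∧ ¬ p t).card : ℝ), card_le φi (fun t => ¬ p t) E,
      le_max_left ((E.filter φi).card : ℝ) ((E.filter φj).card : ℝ)]
  obtain ⟨hi, hi'⟩ := card_filter_cons_bounds φi t D
  obtain ⟨hj, hj'⟩ := card_filter_cons_bounds φj t D
  obtain ⟨hni, hni'⟩ := card_filter_cons_bounds (fun t => φi t ∧ ¬ p t) t D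
  obtain ⟨hnj, hnj'⟩ := card_filter_cons_bounds (fun t => φj t ∧ ¬ p t) t D
  rw [hI, hI]
  apply abs_mul_div_sub_mul_div_le hM
  · positivity
  · positivity
  · exact min_le (t ::ₘ D)
  · exact min_le_min hni hnj
  · rw [← min_add_add_right]
    exact min_le_min hni' hnj'
  · gcongr
  · rw [← max_add_add_right ((D.filter φi).card : ℝ)]
    gcongr
  · set x : ℝ := max ((D.filter φi).card : ℝ) ((D.filter φj).card : ℝ)
    have hbound (φ : T → Prop) [DecidablePred φ] (hφ : ((D.filter φ).card : ℝ) ≤ x) :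
        |((D.filter fun t => φ t ∧ p t).map v).sum| ≤ M * (x + 1) :=
      (abs_sum_map_le_mul_card hv _).trans
        (mul_le_mul_of_nonneg_left (by linarith [card_le φ p D]) hM)
    refine (abs_sub _ _).trans ?_
    linarith [hbound φi (le_max_left _ _), hbound φj (le_max_right _ _)]
  · by_cases h1 : φi t <;> by_cases h2 : φj t <;> by_cases h3 : p t <;>
      simp [h1, h2, h3, hM, hv]

/-- Sensitivity of the SUM influence function: for neighboring databases `D, D'`,
`|I(p; D) − I(p; D')| ≤ 4M`. -/
theorem sum_influence_sensitivity {T : Type*}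
    (v : T → ℝ) (M : ℝ) (hM : 0 ≤ M) (hv : ∀ t : T, |v t| ≤ M)
    (φi φj p : T → Prop) [DecidablePred φi] [DecidablePred φj] [DecidablePred p]
    (I : Multiset T → ℝ)
    (hI : ∀ D : Multiset T,
      I D = (((D.filter fun t => φi t ∧ p t).map v).sum
              - ((D.filter fun t => φj t ∧ p t).map v).sum)
            * min ((D.filter fun t => φi t ∧ ¬ p t).card : ℝ)
                  ((D.filter fun t => φj t ∧ ¬ p t).card : ℝ)
            / (max ((D.filter φi).card : ℝ) ((D.filter φj).card : ℝ) + 1))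
    (D D' : Multiset T)
    (hneighbor : (∃ t, D' = t ::ₘ D) ∨ (∃ t, D = t ::ₘ D')) :
    |I D - I D'| ≤ 4 * M := by
  rcases hneighbor with ⟨t, rfl⟩ | ⟨t, rfl⟩
  · linarith [abs_sum_influence_sub_cons_le hM hv φi φj p hI D t]
  · rw [abs_sub_comm]
    linarith [abs_sum_influence_sub_cons_le hM hv φi φj p hI D' t]
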